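/- (Strong-force action lower bound along a path) Let 𝒩 be an open neighborhood of 0 in ℝ^k, U ∈ C¹(𝒩 ∖ {0}, ℝ), and let W : ℝ × (ℝ^k ∖ {0}) → ℝ satisfy −W(t, ξ) ≥ |∇U(ξ)|² for all t and all ξ ∈ 𝒩 ∖ {0}. Let ξ : [a, b] → 𝒩 ∖ {0} be absolutely continuous with square-integrable derivative. Then |U(ξ(b)) − U(ξ(a))| ≤ (1/2) ∫_a^b ( |ξ̇(t)|² − W(t, ξ(t)) ) dt. -/

import Mathlib

open MeasureTheory Filter

noncomputable section

/-- A function whose increments are dominated by those of an absolutely continuous function is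
absolutely continuous. -/
theorem AbsolutelyContinuousOnInterval.of_dist_le {X Y : Type*} [PseudoMetricSpace X]
    [PseudoMetricSpace Y] {f : ℝ → X} {g : ℝ → Y} {a b C : ℝ}
    (hg : AbsolutelyContinuousOnInterval g a b)
    (h : ∀ s ∈ Set.uIcc a b, ∀ t ∈ Set.uIcc a b, dist (f s) (f t) ≤ C * dist (g s) (g t)) :
    AbsolutelyContinuousOnInterval f a b := by
  have hlim := Tendsto.const_mul C hg
  rw [mul_zero] at hlim
  refine squeeze_zero' (Eventually.of_forall fun E => Finset.sum_nonneg fun _ _ => dist_nonneg)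
    ?_ hlim
  filter_upwards [mem_inf_of_right (mem_principal_self _)] with E hE
  rw [Finset.mul_sum]
  exact Finset.sum_le_sum fun i hi => h _ (hE.1 i hi).1 _ (hE.1 i hi).2

/-- A primitive of an interval integrable vector-valued function is absolutely continuous. -/
theorem AbsolutelyContinuousOnInterval.of_sub_eq_integral {E : Type*} [NormedAddCommGroup E]
    [NormedSpace ℝ E] {f v : ℝ → E} {a b : ℝ} (hv : IntervalIntegrable v volume a b)
    (h : ∀ s ∈ Set.uIcc a b, ∀ t ∈ Set.uIcc a b, f t - f s = ∫ u in s..t, v u) :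
    AbsolutelyContinuousOnInterval f a b := by
  refine (hv.norm.absolutelyContinuousOnInterval_intervalIntegral
    Set.left_mem_uIcc).of_dist_le (C := 1) fun s hs t ht => ?_
  have hsub : ∀ x ∈ Set.uIcc a b, IntervalIntegrable (fun u => ‖v u‖) volume a x := fun x hx =>
    hv.norm.mono_set (Set.uIcc_subset_uIcc Set.left_mem_uIcc hx)
  rw [one_mul, dist_eq_norm, h t ht s hs, Real.dist_eq,
    intervalIntegral.integral_interval_sub_left (hsub s hs) (hsub t ht)]
  exact intervalIntegral.norm_integral_le_abs_integral_norm

/-- A primitive of an interval integrable function is differentiable almost everywhere. -/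
theorem IntervalIntegrable.ae_hasDerivAt_of_sub_eq_integral {E : Type*} [NormedAddCommGroup E]
    [NormedSpace ℝ E] [CompleteSpace E] {f v : ℝ → E} {a b : ℝ}
    (hv : IntervalIntegrable v volume a b)
    (h : ∀ t ∈ Set.Icc a b, f t - f a = ∫ u in a..t, v u) :
    ∀ᵐ t, t ∈ Set.Ioc a b → HasDerivAt f (v t) t := by
  filter_upwards [hv.ae_hasDerivAt_integral, Measure.ae_ne volume b] with t ht htb hmem
  have htab : t ∈ Set.uIcc a b := Set.Icc_subset_uIcc (Set.Ioc_subset_Icc_self hmem)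
  refine ((ht htab a Set.left_mem_uIcc).const_add (f a)).congr_of_eventuallyEq ?_
  filter_upwards [Icc_mem_nhds hmem.1 (lt_of_le_of_ne hmem.2 htb)] with s hs
  rw [← h s hs, add_sub_cancel]

/-- A continuously differentiable function on an open set is Lipschitz on compact subsets. -/
theorem ContDiffOn.exists_lipschitzOnWith_of_isCompact_subset {E F : Type*}
    [NormedAddCommGroup E] [NormedSpace ℝ E] [NormedAddCommGroup F] [NormedSpace ℝ F]
    {f : E → F} {s K : Set E} (hf : ContDiffOn ℝ 1 f s) (hs : IsOpen s) (hK : IsCompact K)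
    (hKs : K ⊆ s) : ∃ C, LipschitzOnWith C f K := by
  refine LocallyLipschitzOn.exists_lipschitzOnWith_of_compact hK fun x hx => ?_
  obtain ⟨C, t, ht, hC⟩ := (hf.contDiffAt (hs.mem_nhds (hKs hx))).exists_lipschitzOnWith
  exact ⟨C, t, mem_nhdsWithin_of_mem_nhds ht, hC⟩

/-- The directional derivative is controlled by the mean of the squared norms of the gradient and
the direction. -/
theorem abs_fderiv_apply_le_half_sq_norm_gradient_add {E : Type*} [NormedAddCommGroup E]
    [InnerProductSpace ℝ E] [CompleteSpace E] (f : E → ℝ) (x y : E) :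
    |fderiv ℝ f x y| ≤ 1 / 2 * (‖y‖ ^ 2 + ‖gradient f x‖ ^ 2) := by
  rw [← inner_gradient_left]
  nlinarith [abs_real_inner_le_norm (gradient f x) y, sq_nonneg (‖gradient f x‖ - ‖y‖)]

theorem strong_force_action_lower_bound
    {k : ℕ} (hk : 1 ≤ k)
    (𝒩 : Set (EuclideanSpace ℝ (Fin k))) (h𝒩open : IsOpen 𝒩)
    (h𝒩mem : (0 : EuclideanSpace ℝ (Fin k)) ∈ 𝒩)
    (U : EuclideanSpace ℝ (Fin k) → ℝ)
    (hU : ContDiffOn ℝ 1 U (𝒩 \ {0}))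
    (W : ℝ → EuclideanSpace ℝ (Fin k) → ℝ)
    -- strong force inequality: `-W(t,ξ) ≥ |∇U(ξ)|²` on `𝒩 ∖ {0}`
    (hSF : ∀ t : ℝ, ∀ ξ' ∈ 𝒩 \ {0}, ‖gradient U ξ'‖ ^ 2 ≤ -W t ξ')
    (a b : ℝ) (hab : a ≤ b)
    -- `ξ` is absolutely continuous on `[a,b]` with square-integrable derivative `v`,
    -- and takes values in `𝒩 ∖ {0}`
    (ξ : ℝ → EuclideanSpace ℝ (Fin k))
    (hmem : ∀ t ∈ Set.Icc a b, ξ t ∈ 𝒩 \ {0})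
    (v : ℝ → EuclideanSpace ℝ (Fin k))
    (hvmeas : AEStronglyMeasurable v volume)
    (hv2 : IntegrableOn (fun t => ‖v t‖ ^ 2) (Set.Icc a b))
    (hAC : ∀ s ∈ Set.Icc a b, ∀ t ∈ Set.Icc a b, ξ t - ξ s = ∫ u in s..t, v u)
    -- `t ↦ W(t, ξ(t))` is integrable on `[a,b]`
    (hWint : IntervalIntegrable (fun t => W t (ξ t)) volume a b) :
    |U (ξ b) - U (ξ a)| ≤
      (1 / 2) * ∫ t in a..b, (‖deriv ξ t‖ ^ 2 - W t (ξ t)) := by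
  have hopen : IsOpen (𝒩 \ {0}) := h𝒩open.sdiff isClosed_singleton
  have hu : Set.uIcc a b = Set.Icc a b := Set.uIcc_of_le hab
  have hv2' : IntervalIntegrable (fun t => ‖v t‖ ^ 2) volume a b :=
    (intervalIntegrable_iff_integrableOn_Icc_of_le hab).2 hv2
  have hv : IntervalIntegrable v volume a b :=
    (intervalIntegrable_iff_integrableOn_Icc_of_le hab).2
      (((memLp_two_iff_integrable_sq_norm hvmeas.restrict).2 hv2).integrable one_le_two)
  have hξAC : AbsolutelyContinuousOnInterval ξ a b := .of_sub_eq_integral hv (by rwa [hu])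
  have hξcont : ContinuousOn ξ (Set.Icc a b) := hu ▸ hξAC.continuousOn
  obtain ⟨C, hC⟩ := hU.exists_lipschitzOnWith_of_isCompact_subset hopen
    (isCompact_Icc.image_of_continuousOn hξcont) (Set.image_subset_iff.2 hmem)
  have hUAC : AbsolutelyContinuousOnInterval (fun t => U (ξ t)) a b :=
    hξAC.of_dist_le (C := C) fun s hs t ht => hC.dist_le_mul _
      (Set.mem_image_of_mem ξ (hu ▸ hs)) _ (Set.mem_image_of_mem ξ (hu ▸ ht))
  have hderiv : ∀ᵐ t, t ∈ Set.Ioc a b → HasDerivAt ξ (v t) t :=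
    hv.ae_hasDerivAt_of_sub_eq_integral (hAC a (Set.left_mem_Icc.2 hab))
  have hcongr : ∫ t in a..b, (‖deriv ξ t‖ ^ 2 - W t (ξ t)) =
      ∫ t in a..b, (‖v t‖ ^ 2 - W t (ξ t)) := by
    refine intervalIntegral.integral_congr_ae ?_
    filter_upwards [hderiv] with t ht htab
    rw [(ht (Set.uIoc_of_le hab ▸ htab)).deriv]
  rw [← hUAC.integral_deriv_eq_sub, hcongr, ← intervalIntegral.integral_const_mul,
    ← Real.norm_eq_abs]
  refine intervalIntegral.norm_integral_le_of_norm_le hab ?_ ((hv2'.sub hWint).const_mul _)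
  filter_upwards [hderiv] with t ht htab
  have hξt := hmem t (Set.Ioc_subset_Icc_self htab)
  have hUt : DifferentiableAt ℝ U (ξ t) :=
    (hU.contDiffAt (hopen.mem_nhds hξt)).differentiableAt one_ne_zero
  have hUξ : HasDerivAt (fun t => U (ξ t)) (fderiv ℝ U (ξ t) (v t)) t :=
    hUt.hasFDerivAt.comp_hasDerivAt t (ht htab)
  rw [hUξ.deriv, Real.norm_eq_abs]
  linarith [abs_fderiv_apply_le_half_sq_norm_gradient_add U (ξ t) (v t), hSF t _ hξt]

end
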